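/- The ℂ-subspace {h ∈ H : Δ(h) = h ⊗ 1 + a^p ⊗ h} of (1, a^p)-skew-primitive elements equals the linear span of 1 - a^p and b·a^{p-1}; in particular it is 2-dimensional. -/

import Mathlib

open scoped TensorProduct

noncomputable section

/-- The defining relations of the dual Radford algebra `H_{p,-1}`:
`a^(2p) = 1`, `b² = 0`, `b·a = ξ·(a·b)`, where `a` is `ι 0` and `b` is `ι 1`. -/
inductive HRel (p : ℕ) (ξ : ℂ) : FreeAlgebra ℂ (Fin 2) → FreeAlgebra ℂ (Fin 2) → Prop
  | a_pow : HRel p ξ (FreeAlgebra.ι ℂ (0 : Fin 2) ^ (2 * p)) 1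
  | b_sq : HRel p ξ (FreeAlgebra.ι ℂ (1 : Fin 2) * FreeAlgebra.ι ℂ (1 : Fin 2)) 0
  | b_a : HRel p ξ (FreeAlgebra.ι ℂ (1 : Fin 2) * FreeAlgebra.ι ℂ (0 : Fin 2))
      (ξ • (FreeAlgebra.ι ℂ (0 : Fin 2) * FreeAlgebra.ι ℂ (1 : Fin 2)))

/-- The dual Radford algebra `H_{p,-1}`, the quotient of the free algebra on `a`, `b`
by the two-sided ideal generated by `a^(2p) - 1`, `b²` and `b·a - ξ·a·b`. -/
abbrev DualRadford (p : ℕ) (ξ : ℂ) : Type := RingQuot (HRel p ξ)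

/-- The image of the generator `a` in `H_{p,-1}`. -/
def aH (p : ℕ) (ξ : ℂ) : DualRadford p ξ :=
  RingQuot.mkAlgHom ℂ (HRel p ξ) (FreeAlgebra.ι ℂ (0 : Fin 2))

/-- The image of the generator `b` in `H_{p,-1}`. -/
def bH (p : ℕ) (ξ : ℂ) : DualRadford p ξ :=
  RingQuot.mkAlgHom ℂ (HRel p ξ) (FreeAlgebra.ι ℂ (1 : Fin 2))

namespace DualRadford

variable {p : ℕ} {ξ : ℂ}

theorem aH_pow_two_mul : aH p ξ ^ (2 * p) = 1 := by
  simpa [aH] using RingQuot.mkAlgHom_rel ℂ (HRel.a_pow (p := p) (ξ := ξ))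

theorem bH_mul_bH : bH p ξ * bH p ξ = 0 := by
  simpa [bH] using RingQuot.mkAlgHom_rel ℂ (HRel.b_sq (p := p) (ξ := ξ))

theorem bH_mul_aH : bH p ξ * aH p ξ = ξ • (aH p ξ * bH p ξ) := by
  simpa [aH, bH] using RingQuot.mkAlgHom_rel ℂ (HRel.b_a (p := p) (ξ := ξ))

theorem aH_mul_bH (hξ : ξ ≠ 0) : aH p ξ * bH p ξ = ξ⁻¹ • (bH p ξ * aH p ξ) := by
  rw [bH_mul_aH, inv_smul_smul₀ hξ]

theorem aH_mul_bH_mul (hξ : ξ ≠ 0) (x : DualRadford p ξ) :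
    aH p ξ * (bH p ξ * x) = ξ⁻¹ • (bH p ξ * (aH p ξ * x)) := by
  rw [← mul_assoc, aH_mul_bH hξ, smul_mul_assoc, mul_assoc]

theorem bH_mul_bH_mul (x : DualRadford p ξ) : bH p ξ * (bH p ξ * x) = 0 := by
  rw [← mul_assoc, bH_mul_bH, zero_mul]

theorem aH_pow_mod (n : ℕ) : aH p ξ ^ (n % (2 * p)) = aH p ξ ^ n := by
  conv_rhs => rw [← Nat.div_add_mod n (2 * p), pow_add, pow_mul, aH_pow_two_mul, one_pow, one_mul]

theorem span_monomials (hξ : ξ ≠ 0) :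
    Submodule.span ℂ (Set.range (fun n : ℕ ↦ aH p ξ ^ n) ∪
      Set.range (fun n : ℕ ↦ bH p ξ * aH p ξ ^ n)) = ⊤ := by
  set S := Submodule.span ℂ (Set.range (fun n : ℕ ↦ aH p ξ ^ n) ∪
      Set.range (fun n : ℕ ↦ bH p ξ * aH p ξ ^ n))
  have hpow (n : ℕ) : aH p ξ ^ n ∈ S := Submodule.subset_span (.inl ⟨n, rfl⟩)
  have hbpow (n : ℕ) : bH p ξ * aH p ξ ^ n ∈ S := Submodule.subset_span (.inr ⟨n, rfl⟩)
  have ha : S ≤ S.comap (LinearMap.mulLeft ℂ (aH p ξ)) := by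
    refine Submodule.span_le.2 ?_
    rintro _ (⟨n, rfl⟩ | ⟨n, rfl⟩)
    · simpa [← pow_succ'] using hpow (n + 1)
    · simpa [aH_mul_bH_mul hξ, ← pow_succ'] using S.smul_mem ξ⁻¹ (hbpow (n + 1))
  have hb : S ≤ S.comap (LinearMap.mulLeft ℂ (bH p ξ)) := by
    refine Submodule.span_le.2 ?_
    rintro _ (⟨n, rfl⟩ | ⟨n, rfl⟩)
    · exact hbpow n
    · simp [bH_mul_bH_mul]
  have key (x : FreeAlgebra ℂ (Fin 2)) :
      ∀ y ∈ S, RingQuot.mkAlgHom ℂ (HRel p ξ) x * y ∈ S := by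
    induction x using FreeAlgebra.induction with
    | grade0 r =>
      intro y hy
      rw [AlgHom.commutes, ← Algebra.smul_def]
      exact S.smul_mem r hy
    | grade1 i =>
      fin_cases i
      · exact fun y hy ↦ ha hy
      · exact fun y hy ↦ hb hy
    | mul x₁ x₂ h₁ h₂ =>
      intro y hy
      rw [map_mul, mul_assoc]
      exact h₁ _ (h₂ _ hy)
    | add x₁ x₂ h₁ h₂ =>
      intro y hy
      rw [map_add, add_mul]
      exact S.add_mem (h₁ _ hy) (h₂ _ hy)
  refine eq_top_iff.2 fun x _ ↦ ?_
  obtain ⟨x, rfl⟩ := RingQuot.mkAlgHom_surjective ℂ (HRel p ξ) x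
  simpa using key x 1 (by simpa using hpow 0)

theorem linearMap_ext (hξ : ξ ≠ 0) {M : Type*} [AddCommMonoid M] [Module ℂ M]
    {f g : DualRadford p ξ →ₗ[ℂ] M} (ha : ∀ n : ℕ, f (aH p ξ ^ n) = g (aH p ξ ^ n))
    (hb : ∀ n : ℕ, f (bH p ξ * aH p ξ ^ n) = g (bH p ξ * aH p ξ ^ n)) : f = g := by
  refine LinearMap.ext_on (span_monomials hξ) ?_
  rintro _ (⟨n, rfl⟩ | ⟨n, rfl⟩)
  exacts [ha n, hb n]

/-- A representation by `2 × 2` matrices over the group algebra of `ZMod (2 * p)`. -/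
theorem exists_matrix_rep (hξ : ξ ≠ 0) (hpow : ξ ^ (2 * p) = 1) :
    ∃ ρ : DualRadford p ξ →ₐ[ℂ] Matrix (Fin 2) (Fin 2) (AddMonoidAlgebra ℂ (ZMod (2 * p))),
      ρ (aH p ξ) = Matrix.diagonal ![.single 1 ξ⁻¹, .single 1 1] ∧
      ρ (bH p ξ) = !![0, 1; 0, 0] := by
  let φ : FreeAlgebra ℂ (Fin 2) →ₐ[ℂ]
      Matrix (Fin 2) (Fin 2) (AddMonoidAlgebra ℂ (ZMod (2 * p))) :=
    FreeAlgebra.lift ℂ ![Matrix.diagonal ![.single 1 ξ⁻¹, .single 1 1], !![0, 1; 0, 0]]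
  have hφ : ∀ ⦃x y⦄, HRel p ξ x y → φ x = φ y := by
    rintro _ _ (_ | _ | _)
    · simp only [φ, map_pow, FreeAlgebra.lift_ι_apply, map_one, Matrix.cons_val_zero,
        Matrix.diagonal_pow]
      rw [← Matrix.diagonal_one]
      congr 1
      funext i
      fin_cases i <;>
        simp [AddMonoidAlgebra.single_pow, hpow, AddMonoidAlgebra.one_def, -Nat.cast_mul,
          nsmul_eq_mul, CharP.cast_eq_zero]
    · ext i j : 2
      fin_cases i <;> fin_cases j <;> simp [φ, Matrix.mul_apply]
    · ext i j : 2
      fin_cases i <;> fin_cases j <;>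
        simp [φ, Matrix.mul_apply, Matrix.diagonal, AddMonoidAlgebra.smul_single, hξ]
  refine ⟨RingQuot.liftAlgHom ℂ ⟨φ, hφ⟩, ?_, ?_⟩
  · simp [aH, φ]
  · simp [bH, φ]

/-- The coordinate functionals with respect to the monomials `a ^ n` and `b * a ^ n`. -/
theorem exists_coordinates (hp : 1 ≤ p) (hξ : ξ ≠ 0) (hpow : ξ ^ (2 * p) = 1) :
    ∃ A B : ZMod (2 * p) → DualRadford p ξ →ₗ[ℂ] ℂ,
      (∀ k (n : ℕ), A k (aH p ξ ^ n) = if (n : ZMod (2 * p)) = k then 1 else 0) ∧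
      (∀ k (n : ℕ), A k (bH p ξ * aH p ξ ^ n) = 0) ∧
      (∀ k (n : ℕ), B k (aH p ξ ^ n) = 0) ∧
      (∀ k (n : ℕ), B k (bH p ξ * aH p ξ ^ n) = if (n : ZMod (2 * p)) = k then 1 else 0) ∧
      (∀ x y, (∀ k, A k x = A k y) → (∀ k, B k x = B k y) → x = y) := by
  obtain ⟨ρ, ha, hb⟩ := exists_matrix_rep hξ hpow
  let C (i : Fin 2) (k : ZMod (2 * p)) : DualRadford p ξ →ₗ[ℂ] ℂ :=
    Finsupp.lapply k ∘ₗ (AddMonoidAlgebra.coeffLinearEquiv ℂ).toLinearMap ∘ₗ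
      Matrix.entryLinearMap ℂ _ i 1 ∘ₗ ρ.toLinearMap
  have hC (i k x) : C i k x = (ρ x i 1).coeff k := rfl
  have haC (i k) (n : ℕ) : C i k (aH p ξ ^ n) = if i = 1 ∧ (n : ZMod (2 * p)) = k then 1 else 0 := by
    fin_cases i <;>
      simp [hC, ha, Matrix.diagonal_pow, AddMonoidAlgebra.single_pow, Finsupp.single_apply]
  have hbC (i k) (n : ℕ) : C i k (bH p ξ * aH p ξ ^ n) =
      if i = 0 ∧ (n : ZMod (2 * p)) = k then 1 else 0 := by
    fin_cases i <;>
      simp [hC, ha, hb, Matrix.diagonal_pow, Matrix.mul_apply, AddMonoidAlgebra.single_pow,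
        Finsupp.single_apply]
  have : NeZero (2 * p) := ⟨by omega⟩
  have hsum : ∑ k : ZMod (2 * p), ((C 1 k).smulRight (aH p ξ ^ k.val) +
      (C 0 k).smulRight (bH p ξ * aH p ξ ^ k.val)) = LinearMap.id := by
    refine linearMap_ext hξ (fun n ↦ ?_) (fun n ↦ ?_) <;>
      simp [LinearMap.sum_apply, haC, hbC, ite_smul, ZMod.val_natCast, aH_pow_mod]
  refine ⟨C 1, C 0, by simp [haC], by simp [hbC], by simp [haC], by simp [hbC], ?_⟩
  intro x y hA hB
  rw [← LinearMap.id_apply (R := ℂ) x, ← LinearMap.id_apply (R := ℂ) y, ← hsum]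
  simp [LinearMap.sum_apply, hA, hB]

theorem comul_aH_pow_succ (hξ : ξ ≠ 0)
    {Δ : DualRadford p ξ →ₐ[ℂ] DualRadford p ξ ⊗[ℂ] DualRadford p ξ} {c : ℂ}
    (hΔa : Δ (aH p ξ) = aH p ξ ⊗ₜ[ℂ] aH p ξ + c • (bH p ξ ⊗ₜ[ℂ] (bH p ξ * aH p ξ ^ p)))
    (n : ℕ) :
    Δ (aH p ξ ^ (n + 1)) = (aH p ξ ^ (n + 1)) ⊗ₜ[ℂ] (aH p ξ ^ (n + 1)) +
      (c * ∑ i ∈ Finset.range (n + 1), (ξ⁻¹ ^ 2) ^ i) •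
        ((bH p ξ * aH p ξ ^ n) ⊗ₜ[ℂ] (bH p ξ * aH p ξ ^ (p + n))) := by
  induction n with
  | zero => simp [hΔa]
  | succ n ih =>
    rw [geom_sum_succ, pow_succ', map_mul, ih, hΔa]
    generalize ∑ i ∈ Finset.range (n + 1), (ξ⁻¹ ^ 2) ^ i = s
    simp only [add_mul, mul_add, smul_mul_assoc, mul_smul_comm, Algebra.TensorProduct.tmul_mul_tmul,
      aH_mul_bH_mul hξ, bH_mul_bH_mul, TensorProduct.zero_tmul, smul_zero, add_zero,
      ← TensorProduct.smul_tmul', TensorProduct.tmul_smul, smul_smul, mul_assoc, ← pow_succ',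
      ← pow_add]
    rw [add_assoc, ← add_assoc p n 1, ← add_smul]
    congr 2
    ring

theorem comul_bH_mul_aH_pow (hξ : ξ ≠ 0)
    {Δ : DualRadford p ξ →ₐ[ℂ] DualRadford p ξ ⊗[ℂ] DualRadford p ξ} {c : ℂ}
    (hΔa : Δ (aH p ξ) = aH p ξ ⊗ₜ[ℂ] aH p ξ + c • (bH p ξ ⊗ₜ[ℂ] (bH p ξ * aH p ξ ^ p)))
    (hΔb : Δ (bH p ξ) = bH p ξ ⊗ₜ[ℂ] (aH p ξ ^ (p + 1)) + aH p ξ ⊗ₜ[ℂ] bH p ξ) (n : ℕ) :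
    Δ (bH p ξ * aH p ξ ^ n) = (bH p ξ * aH p ξ ^ n) ⊗ₜ[ℂ] (aH p ξ ^ (p + 1 + n)) +
      (aH p ξ ^ (n + 1)) ⊗ₜ[ℂ] (bH p ξ * aH p ξ ^ n) := by
  cases n with
  | zero => simp [hΔb]
  | succ n =>
    rw [map_mul, comul_aH_pow_succ hξ hΔa, hΔb]
    simp only [add_mul, mul_add, mul_smul_comm, Algebra.TensorProduct.tmul_mul_tmul,
      bH_mul_bH_mul, TensorProduct.zero_tmul, TensorProduct.tmul_zero, smul_zero, add_zero,
      ← pow_succ', ← pow_add]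

/-- The power `a ^ p` is grouplike. -/
theorem comul_aH_pow_self (hp : 1 ≤ p) (hξ : IsPrimitiveRoot ξ (2 * p))
    {Δ : DualRadford p ξ →ₐ[ℂ] DualRadford p ξ ⊗[ℂ] DualRadford p ξ}
    (hΔa : Δ (aH p ξ) = aH p ξ ⊗ₜ[ℂ] aH p ξ +
      ((ξ - 1) / (ξ + 1))⁻¹ • (bH p ξ ⊗ₜ[ℂ] (bH p ξ * aH p ξ ^ p))) :
    Δ (aH p ξ ^ p) = (aH p ξ ^ p) ⊗ₜ[ℂ] (aH p ξ ^ p) := by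
  have h0 : ξ ≠ 0 := hξ.ne_zero (by omega)
  have h := comul_aH_pow_succ h0 hΔa (p - 1)
  rw [Nat.sub_add_cancel hp] at h
  rw [h]
  obtain rfl | hp1 := hp.eq_or_lt
  · have : ξ = -1 := IsPrimitiveRoot.eq_neg_one_of_two_right hξ
    simp [this]
  · have h2 : IsPrimitiveRoot (ξ⁻¹ ^ 2) p := hξ.inv.pow (by omega) rfl
    rw [h2.geom_sum_eq_zero hp1, mul_zero, zero_smul, add_zero]

end DualRadford

/-- the space of `(1, a^p)`-skew-primitive elements of `H_{p,-1}` is the span of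
`1 - a^p` and `b·a^(p-1)`; in particular it is `2`-dimensional. -/
theorem statement3 (p : ℕ) (hp : 1 ≤ p) (ξ : ℂ) (hξ : IsPrimitiveRoot ξ (2 * p))
    (Δ : DualRadford p ξ →ₐ[ℂ] DualRadford p ξ ⊗[ℂ] DualRadford p ξ)
    (hΔa : Δ (aH p ξ) = aH p ξ ⊗ₜ[ℂ] aH p ξ +
      ((ξ - 1) / (ξ + 1))⁻¹ • (bH p ξ ⊗ₜ[ℂ] (bH p ξ * aH p ξ ^ p)))
    (hΔb : Δ (bH p ξ) = bH p ξ ⊗ₜ[ℂ] (aH p ξ ^ (p + 1)) + aH p ξ ⊗ₜ[ℂ] bH p ξ) :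
    {h : DualRadford p ξ |
        Δ h = h ⊗ₜ[ℂ] (1 : DualRadford p ξ) + (aH p ξ ^ p) ⊗ₜ[ℂ] h} =
      ↑(Submodule.span ℂ
        ({1 - aH p ξ ^ p, bH p ξ * aH p ξ ^ (p - 1)} : Set (DualRadford p ξ))) ∧
    Module.finrank ℂ
      ↥(Submodule.span ℂ
        ({1 - aH p ξ ^ p, bH p ξ * aH p ξ ^ (p - 1)} : Set (DualRadford p ξ))) = 2 := by
  classical
  have h0 : ξ ≠ 0 := hξ.ne_zero (by omega)
  obtain ⟨A, B, hAa, hAb, hBa, hBb, hAB⟩ := DualRadford.exists_coordinates hp h0 hξ.pow_eq_one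
  have hp_ne : (p : ZMod (2 * p)) ≠ 0 := by
    rw [Ne, ZMod.natCast_eq_zero_iff]
    exact fun h ↦ absurd (Nat.le_of_dvd hp h) (by omega)
  have hpred : ((p - 1 : ℕ) : ZMod (2 * p)) + (p + 1) = 0 := by
    have : ((p - 1 + (p + 1) : ℕ) : ZMod (2 * p)) = 0 := by
      rw [show p - 1 + (p + 1) = 2 * p by omega, ZMod.natCast_self]
    exact_mod_cast this
  have hA1 (k) : A k 1 = if 0 = k then 1 else 0 := by simpa using hAa k 0
  have hB1 (k) : B k 1 = 0 := by simpa using hBa k 0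
  refine ⟨Set.Subset.antisymm (fun h hh ↦ ?_) ?_, ?_⟩
  · rw [Set.mem_ofPred_eq] at hh
    let T (f g : DualRadford p ξ →ₗ[ℂ] ℂ) : DualRadford p ξ ⊗[ℂ] DualRadford p ξ →ₗ[ℂ] ℂ :=
      LinearMap.mul' ℂ ℂ ∘ₗ TensorProduct.map f g
    have hT (f g x y) : T f g (x ⊗ₜ y) = f x * g y := by simp [T]
    have hAA (i j) : T (A i) (A j) (Δ h) = (if i = j then 1 else 0) * A i h := by
      suffices T (A i) (A j) ∘ₗ Δ.toLinearMap = (if i = j then 1 else 0 : ℂ) • A i from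
        LinearMap.congr_fun this h
      refine DualRadford.linearMap_ext h0 (fun n ↦ ?_) (fun n ↦ ?_)
      · cases n with
        | zero =>
          simp only [LinearMap.comp_apply, AlgHom.toLinearMap_apply, pow_zero, map_one,
            Algebra.TensorProduct.one_def, hT, hA1, LinearMap.smul_apply, smul_eq_mul]
          grind
        | succ n =>
          simp only [LinearMap.comp_apply, AlgHom.toLinearMap_apply,
            DualRadford.comul_aH_pow_succ h0 hΔa, map_add, map_smul, hT, hAa, hAb,
            LinearMap.smul_apply, smul_eq_mul]
          grind
      · simp only [LinearMap.comp_apply, AlgHom.toLinearMap_apply,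
          DualRadford.comul_bH_mul_aH_pow h0 hΔa hΔb, map_add, hT, hAb,
          LinearMap.smul_apply, smul_eq_mul, mul_zero, zero_mul, add_zero]
    have hBA (i) : T (B i) (A 0) (Δ h) = (if i + (p + 1) = 0 then 1 else 0) * B i h := by
      suffices T (B i) (A 0) ∘ₗ Δ.toLinearMap = (if i + (p + 1) = 0 then 1 else 0 : ℂ) • B i from
        LinearMap.congr_fun this h
      refine DualRadford.linearMap_ext h0 (fun n ↦ ?_) (fun n ↦ ?_)
      · cases n with
        | zero =>
          simp only [LinearMap.comp_apply, AlgHom.toLinearMap_apply, pow_zero, map_one,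
            Algebra.TensorProduct.one_def, hT, hB1, LinearMap.smul_apply, smul_zero, zero_mul]
        | succ n =>
          simp only [LinearMap.comp_apply, AlgHom.toLinearMap_apply,
            DualRadford.comul_aH_pow_succ h0 hΔa, map_add, map_smul, hT, hBa, hAb,
            LinearMap.smul_apply, smul_eq_mul, mul_zero, zero_mul, add_zero]
      · simp only [LinearMap.comp_apply, AlgHom.toLinearMap_apply,
          DualRadford.comul_bH_mul_aH_pow h0 hΔa hΔb, map_add, hT, hAb, hBb, hBa, hAa,
          LinearMap.smul_apply, smul_eq_mul, mul_zero, add_zero, Nat.cast_add, Nat.cast_one]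
        by_cases hn : (n : ZMod (2 * p)) = i
        · subst hn
          simp [add_comm, add_left_comm]
        · simp [hn]
    have hA (i : ZMod (2 * p)) (hi0 : i ≠ 0) (hip : i ≠ p) : A i h = 0 := by
      simpa [hh, hT, hA1, hAa, hi0.symm, hip.symm] using (hAA i i).symm
    have hAp : A p h + A 0 h = 0 := by
      simpa [hh, hT, hA1, hAa, hp_ne] using hAA p 0
    have hB (i : ZMod (2 * p)) (hi : i ≠ (p - 1 : ℕ)) : B i h = 0 := by
      have hi' : i + (p + 1) ≠ 0 := fun e ↦ hi (add_right_cancel (e.trans hpred.symm))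
      simpa [hh, hT, hA1, hBa, hi'] using hBA i
    refine Submodule.mem_span_pair.2 ⟨A 0 h, B (p - 1 : ℕ) h, hAB _ _ (fun k ↦ ?_) (fun k ↦ ?_)⟩
    · simp only [map_add, map_sub, map_smul, hA1, hAa, hAb, smul_eq_mul]
      by_cases hk0 : k = 0
      · subst hk0
        simp [hp_ne]
      · by_cases hkp : k = p
        · subst hkp
          simp [hp_ne.symm]
          linear_combination -hAp
        · simp [hA k hk0 hkp, Ne.symm hk0, Ne.symm hkp]
    · simp only [map_add, map_sub, map_smul, hB1, hBa, hBb, smul_eq_mul]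
      by_cases hk : k = (p - 1 : ℕ)
      · subst hk
        simp
      · simp [hB k hk, Ne.symm hk]
  · intro h hh
    obtain ⟨s, t, rfl⟩ := Submodule.mem_span_pair.1 hh
    have hg := DualRadford.comul_aH_pow_self hp hξ hΔa
    have hb := DualRadford.comul_bH_mul_aH_pow h0 hΔa hΔb (p - 1)
    rw [show p + 1 + (p - 1) = 2 * p by omega, DualRadford.aH_pow_two_mul,
      Nat.sub_add_cancel hp] at hb
    rw [Set.mem_ofPred_eq, sub_eq_add_neg, ← neg_one_smul ℂ (aH p ξ ^ p)]
    simp only [map_add, map_smul, map_one, hg, hb, Algebra.TensorProduct.one_def, smul_add,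
      TensorProduct.add_tmul, TensorProduct.tmul_add, ← TensorProduct.smul_tmul', TensorProduct.tmul_smul]
    module
  · have hli : LinearIndependent ℂ ![1 - aH p ξ ^ p, bH p ξ * aH p ξ ^ (p - 1)] := by
      refine LinearIndependent.pair_iff.2 fun s t hst ↦ ⟨?_, ?_⟩
      · simpa [hA1, hAa, hAb, hp_ne] using congrArg (A 0) hst
      · simpa [hB1, hBa, hBb] using congrArg (B (p - 1 : ℕ)) hst
    rw [← Matrix.range_cons_cons_empty _ _ ![], finrank_span_eq_card hli, Fintype.card_fin]
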